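/- Let b > 0, d ∈ ℝ and σ ∈ ℝ with σ > 0 and σ > b − d. Then ∫₀^∞ x^{σ−1} e^{−x} f_{b,d}(x) dx = Γ(σ)·Γ(σ+d−b)/Γ(σ+d), where f_{b,d}(x) = (1/Γ(b)) ∫₀^∞ e^{−tx} t^{b−1} (1+t)^{−d} dt. (This encodes the fractional moment formula E[(β(a,b)·γ(c))^s] = Γ(a+s)Γ(c+s)Γ(a+b)/(Γ(a)Γ(c)Γ(a+b+s)) for the product of independent Beta(a,b) and Gamma(c) random variables, with σ = c+s and d = a+b−c.) -/

import Mathlib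

/-- `f b d x = Ψ(b, b+1-d, x)`, the Tricomi confluent hypergeometric function,
given by its integral representation. -/
noncomputable def tricomiF (b d x : ℝ) : ℝ :=
  (1 / Real.Gamma b) * ∫ t in Set.Ioi (0:ℝ), Real.exp (-t * x) * t ^ (b - 1) * (1 + t) ^ (-d)

open MeasureTheory Set

/-- The Gamma integrand `x ^ (s - 1) * exp (-(r * x))` is integrable on `(0, ∞)`. -/
lemma integrableOn_rpow_sub_one_mul_exp_neg_mul {s r : ℝ} (hs : 0 < s) (hr : 0 < r) :
    IntegrableOn (fun x : ℝ => x ^ (s - 1) * Real.exp (-(r * x))) (Ioi 0) := by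
  simpa [neg_mul] using
    integrableOn_rpow_mul_exp_neg_mul_rpow (p := 1) (s := s - 1) (by linarith) one_pos hr

lemma betaPrime_kernel_eq (b s x t : ℝ) :
    x ^ (s - 1) * Real.exp (-((1 + t) * x)) * t ^ (b - 1) =
      x ^ (s - 1) * Real.exp (-x) * (t ^ (b - 1) * Real.exp (-(x * t))) := by
  rw [show -((1 + t) * x) = -x + -(x * t) by ring, Real.exp_add]
  ring

lemma integral_betaPrime_kernel_right {b c x : ℝ} (hb : 0 < b) (hx : 0 < x) :
    ∫ t in Ioi (0 : ℝ), x ^ (b + c - 1) * Real.exp (-((1 + t) * x)) * t ^ (b - 1) =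
      x ^ (c - 1) * Real.exp (-(1 * x)) * Real.Gamma b := by
  simp only [betaPrime_kernel_eq]
  rw [integral_const_mul, Real.integral_rpow_mul_exp_neg_mul_Ioi hb hx, one_div,
    Real.inv_rpow hx.le, show b + c - 1 = b + (c - 1) by ring, Real.rpow_add hx, one_mul]
  have := (Real.rpow_pos_of_pos hx b).ne'
  field_simp

lemma integral_rpow_mul_exp_neg_one_add_mul {s t : ℝ} (hs : 0 < s) (ht : 0 < t) :
    ∫ x in Ioi (0 : ℝ), x ^ (s - 1) * Real.exp (-((1 + t) * x)) =
      Real.Gamma s * (1 + t) ^ (-s) := by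
  have h : 0 < 1 + t := by positivity
  rw [Real.integral_rpow_mul_exp_neg_mul_Ioi hs h, one_div, Real.inv_rpow h.le,
    Real.rpow_neg h.le, mul_comm]

lemma integral_betaPrime_kernel_left {b s t : ℝ} (hs : 0 < s) (ht : 0 < t) :
    ∫ x in Ioi (0 : ℝ), x ^ (s - 1) * Real.exp (-((1 + t) * x)) * t ^ (b - 1) =
      Real.Gamma s * (t ^ (b - 1) * (1 + t) ^ (-s)) := by
  rw [integral_mul_const, integral_rpow_mul_exp_neg_one_add_mul hs ht]
  ring

lemma integrable_betaPrime_kernel {b c : ℝ} (hb : 0 < b) (hc : 0 < c) :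
    Integrable (fun p : ℝ × ℝ => p.1 ^ (b + c - 1) * Real.exp (-((1 + p.2) * p.1)) *
      p.2 ^ (b - 1)) ((volume.restrict (Ioi 0)).prod (volume.restrict (Ioi 0))) := by
  rw [integrable_prod_iff (Measurable.aestronglyMeasurable (by fun_prop))]
  constructor
  · filter_upwards [ae_restrict_mem measurableSet_Ioi] with x hx
    simp only [betaPrime_kernel_eq]
    exact (integrableOn_rpow_sub_one_mul_exp_neg_mul hb hx).const_mul _
  · refine ((integrableOn_rpow_sub_one_mul_exp_neg_mul hc one_pos).mul_const
      (Real.Gamma b)).congr ?_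
    filter_upwards [ae_restrict_mem measurableSet_Ioi] with x (hx : 0 < x)
    rw [← integral_betaPrime_kernel_right hb hx]
    refine setIntegral_congr_fun measurableSet_Ioi fun t (ht : 0 < t) => ?_
    exact (Real.norm_of_nonneg (by positivity)).symm

lemma integrableOn_rpow_mul_one_add_rpow_neg {b c : ℝ} (hb : 0 < b) (hc : 0 < c) :
    IntegrableOn (fun t : ℝ => t ^ (b - 1) * (1 + t) ^ (-(b + c))) (Ioi 0) := by
  have hbc : 0 < b + c := by positivity
  refine ((integrable_betaPrime_kernel hb hc).integral_prod_right.const_mul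
    (Real.Gamma (b + c))⁻¹).congr ?_
  filter_upwards [ae_restrict_mem measurableSet_Ioi] with t ht
  have hG := (Real.Gamma_pos_of_pos hbc).ne'
  rw [integral_betaPrime_kernel_left hbc ht, inv_mul_cancel_left₀ hG]

/-- The Beta integral over `(0, ∞)`. -/
lemma integral_rpow_mul_one_add_rpow_neg {b c : ℝ} (hb : 0 < b) (hc : 0 < c) :
    ∫ t in Ioi (0 : ℝ), t ^ (b - 1) * (1 + t) ^ (-(b + c)) =
      Real.Gamma b * Real.Gamma c / Real.Gamma (b + c) := by
  have hbc : 0 < b + c := by positivity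
  have swap := integral_integral_swap
    (f := fun x t : ℝ => x ^ (b + c - 1) * Real.exp (-((1 + t) * x)) * t ^ (b - 1))
    (integrable_betaPrime_kernel hb hc)
  rw [setIntegral_congr_fun measurableSet_Ioi fun t ht => integral_betaPrime_kernel_left hbc ht,
    setIntegral_congr_fun measurableSet_Ioi fun x hx => integral_betaPrime_kernel_right hb hx,
    integral_const_mul, integral_mul_const,
    Real.integral_rpow_mul_exp_neg_mul_Ioi hc one_pos] at swap
  rw [eq_div_iff (Real.Gamma_pos_of_pos hbc).ne', mul_comm, ← swap]
  simp [mul_comm]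

lemma one_add_rpow_neg_mul_rpow_neg {t : ℝ} (ht : 0 < t) (b d σ : ℝ) :
    t ^ (b - 1) * (1 + t) ^ (-d) * (1 + t) ^ (-σ) =
      t ^ (b - 1) * (1 + t) ^ (-(b + (σ + d - b))) := by
  rw [mul_assoc, ← Real.rpow_add (by positivity)]
  ring_nf

lemma integrable_tricomiF_kernel {b d σ : ℝ} (hb : 0 < b) (hσ : 0 < σ) (hσ' : b - d < σ) :
    Integrable (fun p : ℝ × ℝ => p.1 ^ (σ - 1) * Real.exp (-((1 + p.2) * p.1)) *
      (p.2 ^ (b - 1) * (1 + p.2) ^ (-d)))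
      ((volume.restrict (Ioi 0)).prod (volume.restrict (Ioi 0))) := by
  rw [integrable_prod_iff' (Measurable.aestronglyMeasurable (by fun_prop))]
  constructor
  · filter_upwards [ae_restrict_mem measurableSet_Ioi] with t (ht : 0 < t)
    exact (integrableOn_rpow_sub_one_mul_exp_neg_mul hσ (by positivity)).mul_const _
  · refine ((integrableOn_rpow_mul_one_add_rpow_neg hb
      (show 0 < σ + d - b by linarith)).const_mul (Real.Gamma σ)).congr ?_
    filter_upwards [ae_restrict_mem measurableSet_Ioi] with t (ht : 0 < t)
    rw [← one_add_rpow_neg_mul_rpow_neg ht, mul_left_comm,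
      ← integral_rpow_mul_exp_neg_one_add_mul hσ ht, mul_comm, ← integral_mul_const]
    refine setIntegral_congr_fun measurableSet_Ioi fun x (hx : 0 < x) => ?_
    exact (Real.norm_of_nonneg (by positivity)).symm

/-- The fractional moment formula for the Beta-Gamma product, in the form
`∫₀^∞ x^{σ-1} e^{-x} f_{b,d}(x) dx = Γ(σ)Γ(σ+d-b)/Γ(σ+d)` for `σ > 0`, `σ > b - d`. -/
theorem integral_tricomiF_moment (b d σ : ℝ) (hb : 0 < b) (hσ : 0 < σ) (hσ' : b - d < σ) :
    ∫ x in Set.Ioi (0:ℝ), x ^ (σ - 1) * Real.exp (-x) * tricomiF b d x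
      = Real.Gamma σ * Real.Gamma (σ + d - b) / Real.Gamma (σ + d) := by
  have expand (x : ℝ) : x ^ (σ - 1) * Real.exp (-x) * tricomiF b d x =
      (1 / Real.Gamma b) * ∫ t in Ioi (0 : ℝ),
        x ^ (σ - 1) * Real.exp (-((1 + t) * x)) * (t ^ (b - 1) * (1 + t) ^ (-d)) := by
    rw [tricomiF, mul_left_comm, ← integral_const_mul]
    congr 2 with t
    rw [show -((1 + t) * x) = -x + -t * x by ring, Real.exp_add]
    ring
  have inner : ∀ t ∈ Ioi (0 : ℝ), ∫ x in Ioi (0 : ℝ),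
      x ^ (σ - 1) * Real.exp (-((1 + t) * x)) * (t ^ (b - 1) * (1 + t) ^ (-d)) =
        Real.Gamma σ * (t ^ (b - 1) * (1 + t) ^ (-(b + (σ + d - b)))) := by
    intro t ht
    rw [integral_mul_const, integral_rpow_mul_exp_neg_one_add_mul hσ ht,
      ← one_add_rpow_neg_mul_rpow_neg ht]
    ring
  simp only [expand]
  rw [integral_const_mul, integral_integral_swap (integrable_tricomiF_kernel hb hσ hσ'),
    setIntegral_congr_fun measurableSet_Ioi inner, integral_const_mul,
    integral_rpow_mul_one_add_rpow_neg hb (by linarith), add_sub_cancel]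
  have := (Real.Gamma_pos_of_pos hb).ne'
  field_simp
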